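/- For every z>0, log z + ∫_0^z (e^{−t}−1)/t dt + ∫_z^∞ e^{−t}/t dt = −γ, where γ is the Euler–Mascheroni constant. -/

import Mathlib

open MeasureTheory Set Real

open Filter Topology Asymptotics in
theorem mellinConvergent_and_hasDerivAt_mellin_exp_neg_one :
    MellinConvergent (fun t : ℝ => Real.log t • (Real.exp (-t) : ℂ)) 1 ∧
      HasDerivAt (mellin fun t : ℝ => (Real.exp (-t) : ℂ))
        (mellin (fun t : ℝ => Real.log t • (Real.exp (-t) : ℂ)) 1) 1 := by
  refine mellin_hasDerivAt_of_isBigO_rpow (a := 2) (b := 0) ?_ ?_ (by norm_num) ?_ (by norm_num)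
  · exact (Continuous.continuousOn (by fun_prop)).locallyIntegrableOn measurableSet_Ioi
  · rw [← isBigO_norm_left]
    simp_rw [Complex.norm_real, isBigO_norm_left]
    simpa only [neg_one_mul] using (isLittleO_exp_neg_mul_rpow_atTop zero_lt_one _).isBigO
  · simp_rw [neg_zero, rpow_zero]
    have h : Continuous fun t : ℝ => (Real.exp (-t) : ℂ) := by fun_prop
    exact isBigO_const_of_tendsto (y := (Real.exp (-0) : ℂ)) (h.tendsto 0 |>.mono_left
      nhdsWithin_le_nhds) one_ne_zero

theorem integrableOn_log_mul_exp_neg :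
    IntegrableOn (fun t => Real.log t * Real.exp (-t)) (Ioi 0) := by
  have h := mellinConvergent_and_hasDerivAt_mellin_exp_neg_one.1
  simp only [MellinConvergent, sub_self, Complex.cpow_zero, one_smul, Complex.real_smul,
    ← Complex.ofReal_mul] at h
  exact h.re

theorem integral_log_mul_exp_neg :
    ∫ t in Ioi (0 : ℝ), Real.log t * Real.exp (-t) = -Real.eulerMascheroniConstant := by
  have h := mellinConvergent_and_hasDerivAt_mellin_exp_neg_one.2
  rw [← Complex.GammaIntegral_eq_mellin] at h
  have hG : Complex.Gamma =ᶠ[nhds 1] Complex.GammaIntegral := by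
    have hU : {s : ℂ | 0 < s.re} ∈ nhds (1 : ℂ) :=
      (isOpen_lt continuous_const Complex.continuous_re).mem_nhds (by simp)
    filter_upwards [hU] with s hs using Complex.Gamma_eq_integral hs
  have h' := Complex.hasDerivAt_Gamma_one.unique (h.congr_of_eventuallyEq hG)
  simp only [mellin, sub_self, Complex.cpow_zero, one_smul, Complex.real_smul,
    ← Complex.ofReal_mul, integral_complex_ofReal] at h'
  exact_mod_cast h'.symm

theorem abs_exp_neg_sub_one_le {t : ℝ} (ht : 0 ≤ t) : |Real.exp (-t) - 1| ≤ t := by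
  have h1 : Real.exp (-t) ≤ 1 := Real.exp_le_one_iff.2 (by linarith)
  rw [abs_of_nonpos (by linarith)]
  linarith [Real.add_one_le_exp (-t)]

theorem integrableOn_exp_neg_sub_one_div (z : ℝ) :
    IntegrableOn (fun t => (Real.exp (-t) - 1) / t) (Ioo 0 z) := by
  refine IntegrableOn.of_bound (C := 1) (by simp)
    (Measurable.aestronglyMeasurable (by fun_prop)) ?_
  filter_upwards [ae_restrict_mem measurableSet_Ioo] with t ht
  rw [Real.norm_eq_abs, abs_div, abs_of_pos ht.1]
  exact div_le_one_of_le₀ (abs_exp_neg_sub_one_le ht.1.le) ht.1.le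

theorem integrableOn_exp_neg_div {z : ℝ} (hz : 0 < z) :
    IntegrableOn (fun t => Real.exp (-t) / t) (Ioi z) := by
  refine ((integrableOn_exp_neg_Ioi z).div_const z).mono'
    (Measurable.aestronglyMeasurable (by fun_prop)) ?_
  filter_upwards [ae_restrict_mem measurableSet_Ioi] with t (ht : z < t)
  have ht0 : 0 < t := hz.trans ht
  rw [Real.norm_of_nonneg (by positivity)]
  gcongr

theorem hasDerivAt_exp_neg (t : ℝ) :
    HasDerivAt (fun t => Real.exp (-t)) (-Real.exp (-t)) t := by
  simpa using (hasDerivAt_neg t).exp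

open Filter Topology in
theorem integral_exp_neg_sub_one_div {z : ℝ} (hz : 0 < z) :
    ∫ t in Ioo 0 z, (Real.exp (-t) - 1) / t =
      Real.log z * (Real.exp (-z) - 1) + ∫ t in Ioc 0 z, Real.log t * Real.exp (-t) := by
  have hint : IntegrableOn (fun t => Real.log t * Real.exp (-t)) (Ioc 0 z) :=
    integrableOn_log_mul_exp_neg.mono_set Ioc_subset_Ioi_self
  have hint' : IntegrableOn (fun t => (Real.exp (-t) - 1) / t) (Ioc 0 z) :=
    (integrableOn_Ioc_iff_integrableOn_Ioo).2 (integrableOn_exp_neg_sub_one_div z)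
  have hderiv : ∀ t, 0 < t → HasDerivAt (fun t => Real.log t * (Real.exp (-t) - 1))
      ((Real.exp (-t) - 1) / t - Real.log t * Real.exp (-t)) t := fun t ht => by
    convert! (Real.hasDerivAt_log ht.ne').mul ((hasDerivAt_exp_neg t).sub_const 1) using 1
    ring
  have hzero : Tendsto (fun t => Real.log t * (Real.exp (-t) - 1)) (𝓝[>] 0) (𝓝 0) := by
    have hlog : Tendsto (fun t : ℝ => |t * Real.log t|) (𝓝[>] 0) (𝓝 0) := by
      simpa using (Real.continuous_mul_log.abs.tendsto 0).mono_left nhdsWithin_le_nhds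
    refine squeeze_zero_norm' ?_ hlog
    filter_upwards [self_mem_nhdsWithin] with t (ht : 0 < t)
    rw [norm_mul, Real.norm_eq_abs, Real.norm_eq_abs, abs_mul, mul_comm, abs_of_pos ht]
    gcongr
    exact abs_exp_neg_sub_one_le ht.le
  have h := intervalIntegral.integral_eq_sub_of_hasDerivAt_of_tendsto hz
    (fun t ht => hderiv t ht.1)
    ((intervalIntegrable_iff_integrableOn_Ioc_of_le hz.le).2 (hint'.sub hint)) hzero
    ((hderiv z hz).continuousAt.tendsto.mono_left nhdsWithin_le_nhds)
  rw [intervalIntegral.integral_of_le hz.le, integral_sub hint' hint,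
    integral_Ioc_eq_integral_Ioo] at h
  linarith

open Filter Topology in
theorem integral_exp_neg_div {z : ℝ} (hz : 0 < z) :
    ∫ t in Ioi z, Real.exp (-t) / t =
      -(Real.log z * Real.exp (-z)) + ∫ t in Ioi z, Real.log t * Real.exp (-t) := by
  have hint : IntegrableOn (fun t => Real.log t * Real.exp (-t)) (Ioi z) :=
    integrableOn_log_mul_exp_neg.mono_set (Ioi_subset_Ioi hz.le)
  have hint' := integrableOn_exp_neg_div hz
  have hderiv : ∀ t ∈ Ici z, HasDerivAt (fun t => Real.log t * Real.exp (-t))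
      (Real.exp (-t) / t - Real.log t * Real.exp (-t)) t := fun t ht => by
    convert! (Real.hasDerivAt_log (hz.trans_le ht).ne').mul (hasDerivAt_exp_neg t) using 1
    ring
  have hzero : Tendsto (fun t => Real.log t * Real.exp (-t)) atTop (𝓝 0) :=
    tendsto_zero_of_hasDerivAt_of_integrableOn_Ioi
      (fun t ht => hderiv t (Ioi_subset_Ici_self ht)) (hint'.sub hint) hint
  have h := integral_Ioi_of_hasDerivAt_of_tendsto' hderiv (hint'.sub hint) hzero
  rw [integral_sub hint' hint] at h
  linarith

/-- For every `z > 0`,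
`log z + ∫_0^z (e^{−t}−1)/t dt + ∫_z^∞ e^{−t}/t dt = −γ`,
where `γ` is the Euler–Mascheroni constant. -/
theorem statement15 (z : ℝ) (hz : 0 < z) :
    Real.log z + (∫ t in Ioo (0:ℝ) z, (Real.exp (-t) - 1) / t)
      + (∫ t in Ioi z, Real.exp (-t) / t)
      = -Real.eulerMascheroniConstant := by
  have hsplit := setIntegral_union (Ioc_disjoint_Ioi (le_refl z)) measurableSet_Ioi
    (integrableOn_log_mul_exp_neg.mono_set (Ioc_subset_Ioi_self : Ioc 0 z ⊆ Ioi 0))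
    (integrableOn_log_mul_exp_neg.mono_set (Ioi_subset_Ioi hz.le))
  rw [Ioc_union_Ioi_eq_Ioi hz.le, integral_log_mul_exp_neg] at hsplit
  rw [integral_exp_neg_sub_one_div hz, integral_exp_neg_div hz, hsplit]
  ring
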